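/- For all n ≥ k ≥ 1, every sequence of CTRs α₁ ≥ … ≥ α_k ≥ 0, and every ρ with 36 ≤ ρ ≤ 3k, there exists a universally truthful uniform-price randomized mechanism (a finite probability space (Ω, μ) with a deterministic truthful mechanism M_ω for each ω, where for each ω and each reported profile there is a single unit price Z ≥ 0 such that every bidder assigned a non-dummy slot j pays Z·α_j and every unassigned bidder pays 0) such that for every true profile (v, γ) ∈ (0,∞)ⁿ × [0,∞)ⁿ satisfying v_i·α₁ < OPT(v)/ρ for every bidder i, the expected social welfare at the truthful report is at least (3/8)·(1 − √(1 − ρ/(3k)))²·OPT(v). (Theorem 5.) -/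

import Mathlib

open Finset

/-- CTR of slot `j` among `k` real slots; slot index `k` is the dummy slot with CTR `0`. -/
noncomputable def ctr (k : ℕ) (α : Fin k → ℝ) (j : Fin (k + 1)) : ℝ :=
  if h : (j : ℕ) < k then α ⟨j, h⟩ else 0

/-- A feasible assignment: each non-dummy slot is assigned to at most one bidder. -/
def Feasible (n k : ℕ) (π : Fin n → Fin (k + 1)) : Prop :=
  ∀ i j : Fin n, π i = π j → (π i : ℕ) < k → i = j

/-- Social welfare of the assignment `π` under values `v`. -/
noncomputable def welfare (n k : ℕ) (α : Fin k → ℝ) (v : Fin n → ℝ)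
    (π : Fin n → Fin (k + 1)) : ℝ :=
  ∑ i, v i * ctr k α (π i)

/-- Optimal social welfare. -/
noncomputable def OPT (n k : ℕ) (α : Fin k → ℝ) (v : Fin n → ℝ) : ℝ :=
  sSup {w : ℝ | ∃ π : Fin n → Fin (k + 1), Feasible n k π ∧ w = welfare n k α v π}

/-- Truthfulness of a deterministic mechanism `(asg, pay)` in the private allowance setting. -/
def TruthfulPriv (n k : ℕ) (α : Fin k → ℝ)
    (asg : (Fin n → ℝ) → (Fin n → ℝ) → Fin n → Fin (k + 1))
    (pay : (Fin n → ℝ) → (Fin n → ℝ) → Fin n → ℝ) : Prop :=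
  ∀ v γ : Fin n → ℝ, (∀ j, 0 < v j) → (∀ j, 0 ≤ γ j) → ∀ i : Fin n,
    pay v γ i ≤ v i * ctr k α (asg v γ i) ∧
    ∀ b' g' : ℝ, 0 < b' → 0 ≤ g' →
      (pay (Function.update v i b') (Function.update γ i g') i ≤
        v i * ctr k α (asg (Function.update v i b') (Function.update γ i g') i)) →
      v i * ctr k α (asg v γ i) - max 0 (pay v γ i - γ i) ≥
        v i * ctr k α (asg (Function.update v i b') (Function.update γ i g') i)
          - max 0 (pay (Function.update v i b') (Function.update γ i g') i - γ i)

/-! ### Sampled price and priority queue -/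

/-- The `h`-th highest bid inside the sample `S` (and `0` if `S` has fewer than `h` members). -/
noncomputable def samplePrice {n : ℕ} (h : ℕ) (b : Fin n → ℝ) (S : Finset (Fin n)) : ℝ :=
  ((S.filter fun i => h ≤ (S.filter fun j => b i ≤ b j).card).sup
    fun i => (b i).toNNReal : NNReal)

/-- The bidders outside the sample whose bid reaches the sampled price. -/
noncomputable def eligible {n : ℕ} (h : ℕ) (b : Fin n → ℝ) (S : Finset (Fin n)) :
    Finset (Fin n) :=
  Sᶜ.filter fun i => samplePrice h b S ≤ b i

/-- The first `k` members of `E`, in index order, receive the slots `t, t + 1, …` cyclically;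
everybody else receives the dummy slot. -/
def queueSlot {n k : ℕ} (E : Finset (Fin n)) (t : Fin k) (i : Fin n) : Fin (k + 1) :=
  if i ∈ E ∧ (E.filter (· < i)).card < k then
    ⟨((E.filter (· < i)).card + t) % k, (Nat.mod_lt _ t.pos).trans (Nat.lt_succ_self k)⟩
  else Fin.last k

/-- The members of `E` that receive a real slot. -/
def served {n : ℕ} (k : ℕ) (E : Finset (Fin n)) : Finset (Fin n) :=
  E.filter fun i => (E.filter (· < i)).card < k

lemma ctr_last (k : ℕ) (α : Fin k → ℝ) : ctr k α (Fin.last k) = 0 := by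
  simp [ctr]

lemma ctr_nonneg {k : ℕ} {α : Fin k → ℝ} (hα : ∀ j, 0 ≤ α j) (j : Fin (k + 1)) :
    0 ≤ ctr k α j := by
  unfold ctr
  split_ifs
  · exact hα _
  · exact le_rfl

lemma card_filter_lt_strictMono {n : ℕ} {E : Finset (Fin n)} {i j : Fin n} (hi : i ∈ E)
    (hij : i < j) : (E.filter (· < i)).card < (E.filter (· < j)).card := by
  apply Finset.card_lt_card
  refine ⟨fun x hx => ?_, fun hsub => ?_⟩
  · simp only [mem_filter] at hx ⊢
    exact ⟨hx.1, hx.2.trans hij⟩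
  · have := hsub (mem_filter.2 ⟨hi, hij⟩)
    simp at this

lemma card_filter_lt_injOn {n : ℕ} {E : Finset (Fin n)} {i j : Fin n} (hi : i ∈ E) (hj : j ∈ E)
    (h : (E.filter (· < i)).card = (E.filter (· < j)).card) : i = j := by
  rcases lt_trichotomy i j with hij | hij | hij
  · exact absurd h (card_filter_lt_strictMono hi hij).ne
  · exact hij
  · exact absurd h (card_filter_lt_strictMono hj hij).ne'

lemma queueSlot_feasible {n k : ℕ} (E : Finset (Fin n)) (t : Fin k) :
    Feasible n k (queueSlot E t) := by
  intro i j hij hlt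
  by_cases hi : i ∈ E ∧ (E.filter (· < i)).card < k
  · by_cases hj : j ∈ E ∧ (E.filter (· < j)).card < k
    · have h1 : ((E.filter (· < i)).card + t) % k = ((E.filter (· < j)).card + t) % k := by
        have := congrArg Fin.val hij
        simpa only [queueSlot, if_pos hi, if_pos hj] using this
      have h2 : (E.filter (· < i)).card ≡ (E.filter (· < j)).card [MOD k] :=
        Nat.ModEq.add_right_cancel' (t : ℕ) h1
      exact card_filter_lt_injOn hi.1 hj.1 (h2.eq_of_lt_of_lt hi.2 hj.2)
    · rw [hij] at hlt
      simp [queueSlot, if_neg hj] at hlt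
  · simp [queueSlot, if_neg hi] at hlt

lemma queueSlot_eq_ite_insert {n k : ℕ} (E : Finset (Fin n)) (t : Fin k) (i : Fin n) :
    queueSlot E t i = if i ∈ E then queueSlot (insert i E) t i else Fin.last k := by
  split_ifs with h
  · rw [insert_eq_of_mem h]
  · simp [queueSlot, h]

lemma samplePrice_nonneg {n : ℕ} (h : ℕ) (b : Fin n → ℝ) (S : Finset (Fin n)) :
    0 ≤ samplePrice h b S :=
  NNReal.coe_nonneg _

lemma samplePrice_update {n : ℕ} (h : ℕ) (b : Fin n → ℝ) {S : Finset (Fin n)} {i : Fin n}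
    (hi : i ∉ S) (x : ℝ) : samplePrice h (Function.update b i x) S = samplePrice h b S := by
  have hb : ∀ j ∈ S, Function.update b i x j = b j := fun j hj =>
    Function.update_of_ne (ne_of_mem_of_not_mem hj hi) _ _
  have hf : (S.filter fun a => h ≤
      (S.filter fun j => Function.update b i x a ≤ Function.update b i x j).card) =
      S.filter fun a => h ≤ (S.filter fun j => b a ≤ b j).card := by
    refine filter_congr fun a ha => ?_
    rw [filter_congr fun j hj => by rw [hb a ha, hb j hj]]
  unfold samplePrice
  rw [hf]
  congr 1
  exact sup_congr rfl fun a ha => by rw [hb a (mem_filter.1 ha).1]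

lemma insert_eligible_update {n : ℕ} (h : ℕ) (b : Fin n → ℝ) {S : Finset (Fin n)} {i : Fin n}
    (hi : i ∉ S) (x : ℝ) :
    insert i (eligible h (Function.update b i x) S) = insert i (eligible h b S) := by
  ext j
  by_cases hj : j = i
  · simp [hj]
  · simp [eligible, samplePrice_update h b hi x, hj]

lemma truthfulPriv_queue {n k : ℕ} {α : Fin k → ℝ} (hα : ∀ j, 0 ≤ α j) (h : ℕ)
    (S : Finset (Fin n)) (t : Fin k) :
    TruthfulPriv n k α (fun b _ => queueSlot (eligible h b S) t)
      (fun b _ i => samplePrice h b S * ctr k α (queueSlot (eligible h b S) t i)) := by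
  intro v γ hv hγ i
  by_cases hi : i ∈ S
  · have hz : ∀ b : Fin n → ℝ, ctr k α (queueSlot (eligible h b S) t i) = 0 := fun b => by
      rw [queueSlot_eq_ite_insert, if_neg (by simp [eligible, hi]), ctr_last]
    simp [hz]
  · set Z := samplePrice h v S
    set c := ctr k α (queueSlot (insert i (eligible h v S)) t i) with hc
    have hc0 : 0 ≤ c := ctr_nonneg hα _
    have key : ∀ x, ctr k α (queueSlot (eligible h (Function.update v i x) S) t i) =
        if Z ≤ x then c else 0 := by
      intro x
      have hmem : i ∈ eligible h (Function.update v i x) S ↔ Z ≤ x := by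
        simp [eligible, hi, samplePrice_update h v hi x, Z]
      rw [queueSlot_eq_ite_insert, insert_eligible_update h v hi x]
      simp only [hmem]
      split_ifs
      · rfl
      · exact ctr_last _ _
    have key0 := key (v i)
    rw [Function.update_eq_self] at key0
    simp only [samplePrice_update h v hi, key, key0]
    have hvi := hv i
    have hγi := hγ i
    change Z * _ ≤ _ ∧ ∀ b' g' : ℝ, 0 < b' → 0 ≤ g' → Z * _ ≤ _ → _ - max 0 (Z * _ - _) ≥
      _ - max 0 (Z * _ - _)
    by_cases hZ : Z ≤ v i
    · have hle : Z * c ≤ v i * c := mul_le_mul_of_nonneg_right hZ hc0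
      simp only [if_pos hZ]
      refine ⟨hle, fun b' g' _ _ _ => ?_⟩
      split_ifs
      · exact le_rfl
      · have : max 0 (Z * c - γ i) ≤ v i * c := max_le (mul_nonneg hvi.le hc0) (by linarith)
        have h0 : max 0 (-γ i) = 0 := max_eq_left (by linarith)
        simp only [mul_zero, zero_sub, h0]
        linarith
    · simp only [if_neg hZ, mul_zero, zero_sub]
      refine ⟨le_rfl, fun b' g' _ _ => ?_⟩
      split_ifs
      · intro hp
        have hc' : c = 0 := by nlinarith
        simp [hc', hγi]
      · intro
        simp

/-! ### The sampled price -/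

lemma le_samplePrice {n h : ℕ} (hh : 0 < h) {b : Fin n → ℝ} {S : Finset (Fin n)} {x : ℝ}
    (hx : h ≤ (S.filter fun j => x ≤ b j).card) : x ≤ samplePrice h b S := by
  obtain ⟨i, hi, hmin⟩ := exists_min_image (S.filter fun j => x ≤ b j) b
    (card_pos.1 (hh.trans_le hx))
  have hiS := mem_filter.1 hi
  have hmem : i ∈ S.filter fun i => h ≤ (S.filter fun j => b i ≤ b j).card := by
    refine mem_filter.2 ⟨hiS.1, hx.trans (card_le_card fun j hj => ?_)⟩
    exact mem_filter.2 ⟨(mem_filter.1 hj).1, hmin j hj⟩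
  have := le_sup (f := fun i => (b i).toNNReal) hmem
  calc x ≤ b i := hiS.2
    _ ≤ ((b i).toNNReal : ℝ) := Real.le_coe_toNNReal _
    _ ≤ samplePrice h b S := NNReal.coe_le_coe.2 this

lemma card_samplePrice_le {n h : ℕ} (hh : 0 < h) {b : Fin n → ℝ} (hb : ∀ i, 0 ≤ b i)
    {S : Finset (Fin n)} (hS : h ≤ S.card) :
    h ≤ (S.filter fun j => samplePrice h b S ≤ b j).card := by
  have hne : (S.filter fun i => h ≤ (S.filter fun j => b i ≤ b j).card).Nonempty := by
    obtain ⟨i, hi, hmin⟩ := exists_min_image S b (card_pos.1 (hh.trans_le hS))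
    refine ⟨i, mem_filter.2 ⟨hi, ?_⟩⟩
    rwa [filter_true_of_mem hmin]
  obtain ⟨i, hi, he⟩ := exists_mem_eq_sup _ hne fun i => (b i).toNNReal
  have hp : samplePrice h b S = b i := by
    unfold samplePrice
    rw [he, Real.coe_toNNReal _ (hb i)]
  rw [hp]
  exact (mem_filter.1 hi).2

/-! ### Welfare of the queue -/

lemma min_card_le_card_served {n : ℕ} (k : ℕ) (E : Finset (Fin n)) :
    min k E.card ≤ (served k E).card := by
  have himg : E.image (fun i => (E.filter (· < i)).card) = range E.card := by
    apply eq_of_subset_of_card_le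
    · intro x hx
      obtain ⟨i, hi, rfl⟩ := mem_image.1 hx
      refine mem_range.2 (card_lt_card ⟨filter_subset _ _, fun hs => ?_⟩)
      have := hs hi
      simp at this
    · rw [card_range, card_image_of_injOn]
      intro i hi j hj hij
      exact card_filter_lt_injOn hi hj hij
  have hsub : range (min k E.card) ⊆ (served k E).image fun i => (E.filter (· < i)).card := by
    intro x hx
    have hx' := lt_min_iff.1 (mem_range.1 hx)
    have : x ∈ E.image (fun i => (E.filter (· < i)).card) := by
      rw [himg]
      exact mem_range.2 hx'.2
    obtain ⟨i, hi, rfl⟩ := mem_image.1 this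
    exact mem_image.2 ⟨i, mem_filter.2 ⟨hi, hx'.1⟩, rfl⟩
  simpa using (card_le_card hsub).trans card_image_le

lemma sum_ctr_cyclic {k : ℕ} (α : Fin k → ℝ) (p : ℕ) :
    ∑ t : Fin k, ctr k α ⟨(p + t) % k, (Nat.mod_lt _ t.pos).trans (Nat.lt_succ_self k)⟩ =
      ∑ j, α j := by
  rcases Nat.eq_zero_or_pos k with rfl | hk
  · simp
  have : NeZero k := ⟨hk.ne'⟩
  rw [← Equiv.sum_comp (Equiv.addLeft (Fin.ofNat k p)) α]
  refine sum_congr rfl fun t _ => ?_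
  unfold ctr
  rw [dif_pos (Nat.mod_lt _ hk)]
  congr 1
  ext
  simp [Fin.val_add]

lemma sum_welfare_queueSlot {n k : ℕ} (α : Fin k → ℝ) (v : Fin n → ℝ) (E : Finset (Fin n)) :
    ∑ t : Fin k, welfare n k α v (queueSlot E t) = (∑ j, α j) * ∑ i ∈ served k E, v i := by
  unfold welfare
  have hserved : served k E = univ.filter fun i => i ∈ E ∧ (E.filter (· < i)).card < k := by
    ext i
    simp [served]
  rw [sum_comm, mul_sum, hserved, sum_filter]
  refine sum_congr rfl fun i _ => ?_
  by_cases hi : i ∈ E ∧ (E.filter (· < i)).card < k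
  · simp only [queueSlot, if_pos hi]
    rw [← mul_sum, sum_ctr_cyclic, mul_comm]
  · simp only [queueSlot, if_neg hi, ctr_last, mul_zero, sum_const_zero]

/-! ### Random halves -/

lemma sum_sq_two_card_inter_sub {ι : Type*} [Fintype ι] [DecidableEq ι] (G : Finset ι) :
    ∑ S : Finset ι, (2 * ((S ∩ G).card : ℝ) - G.card) ^ 2 =
      Fintype.card (Finset ι) * (G.card : ℝ) := by
  have hrep : ∀ (H : Finset ι) (S : Finset ι), 2 * ((S ∩ H).card : ℝ) - H.card =
      ∑ i ∈ H, if i ∈ S then (1 : ℝ) else -1 := by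
    intro H S
    have h1 : ∀ i, (if i ∈ S then (1 : ℝ) else -1) = 2 * (if i ∈ S then 1 else 0) - 1 := by
      intro i
      split_ifs <;> norm_num
    simp only [h1, sum_sub_distrib, ← mul_sum, sum_boole, sum_const, nsmul_eq_mul, mul_one]
    rw [filter_mem_eq_inter, inter_comm]
  induction G using Finset.induction_on with
  | empty => simp
  | insert a G ha ih =>
    simp only [hrep] at ih ⊢
    simp only [sum_insert ha, add_sq, sum_add_distrib]
    rw [ih]
    have hcross : ∑ S : Finset ι, 2 * (if a ∈ S then (1 : ℝ) else -1) *
        (∑ i ∈ G, if i ∈ S then (1 : ℝ) else -1) = 0 := by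
      set f : Finset ι → ℝ := fun S => 2 * (if a ∈ S then (1 : ℝ) else -1) *
        (∑ i ∈ G, if i ∈ S then (1 : ℝ) else -1) with hf
      have hinv : Function.Involutive (fun S : Finset ι => symmDiff S {a}) :=
        fun S => symmDiff_symmDiff_cancel_right _ _
      have h1 := Equiv.sum_comp (Function.Involutive.toPerm _ hinv) f
      have h2 : ∀ S : Finset ι, f (Function.Involutive.toPerm _ hinv S) = -f S := by
        intro S
        have hG : ∀ i ∈ G, (i ∈ symmDiff S {a} ↔ i ∈ S) := by
          intro i hi
          have : i ≠ a := fun e => ha (e ▸ hi)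
          simp [mem_symmDiff, this]
        simp only [hf, Function.Involutive.coe_toPerm]
        rw [sum_congr rfl fun i hi => by rw [if_congr (hG i hi) rfl rfl]]
        by_cases haS : a ∈ S <;> simp [mem_symmDiff, haS]
      simp only [h2, sum_neg_distrib] at h1
      linarith
    have hone : ∀ S : Finset ι, (if a ∈ S then (1 : ℝ) else -1) ^ 2 = 1 := by
      intro S
      split_ifs <;> norm_num
    rw [hcross]
    simp only [hone, card_insert_of_notMem ha, sum_const, nsmul_eq_mul, card_univ]
    push_cast
    ring

lemma served_pair_lower {n k h : ℕ} (hh : 0 < h) (hhk : h ≤ k) {v : Fin n → ℝ}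
    (hv : ∀ i, 0 < v i) {x : ℝ} (hx : 0 ≤ x)
    (hg : 2 * h < (univ.filter fun i => x ≤ v i).card) (S : Finset (Fin n)) :
    h * x * (1 - (2 * ((S ∩ univ.filter fun i => x ≤ v i).card : ℝ) -
        (univ.filter fun i => x ≤ v i).card) ^ 2 /
          ((univ.filter fun i => x ≤ v i).card - 2 * h) ^ 2) ≤
      ∑ i ∈ served k (eligible h v S), v i + ∑ i ∈ served k (eligible h v Sᶜ), v i := by
  set G := univ.filter fun i => x ≤ v i with hG
  have hF0 : ∀ T, 0 ≤ ∑ i ∈ served k (eligible h v T), v i := fun T =>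
    sum_nonneg fun i _ => (hv i).le
  have hfilter : ∀ T : Finset (Fin n), T.filter (fun j => x ≤ v j) = T ∩ G := by
    intro T
    ext
    simp [hG]
  have hcard : (S ∩ G).card + (Sᶜ ∩ G).card = G.card := by
    rw [← card_union_of_disjoint
      (disjoint_compl_right.mono inter_subset_left inter_subset_left),
      ← union_inter_distrib_right, union_compl, univ_inter]
  have hdpos : (0 : ℝ) < G.card - 2 * h := by
    have : ((2 * h : ℕ) : ℝ) < G.card := by exact_mod_cast hg
    push_cast at this
    linarith
  have hcardR : ((S ∩ G).card : ℝ) + (Sᶜ ∩ G).card = G.card := by exact_mod_cast hcard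
  by_cases hgood : h ≤ (S ∩ G).card ∧ h ≤ (Sᶜ ∩ G).card
  · have main : ∀ T : Finset (Fin n), h ≤ (T ∩ G).card → h ≤ (Tᶜ ∩ G).card →
        samplePrice h v T ≤ samplePrice h v Tᶜ →
        h * x ≤ ∑ i ∈ served k (eligible h v T), v i := by
      intro T hT hT' hle
      have hxZ : x ≤ samplePrice h v T := le_samplePrice hh (by rwa [hfilter])
      have hE : h ≤ (eligible h v T).card :=
        (card_samplePrice_le hh (fun i => (hv i).le)
          (hT'.trans (card_le_card inter_subset_left))).trans
          (card_le_card fun i hi => mem_filter.2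
            ⟨(mem_filter.1 hi).1, hle.trans (mem_filter.1 hi).2⟩)
      have hs : h ≤ (served k (eligible h v T)).card :=
        (le_min hhk hE).trans (min_card_le_card_served k _)
      have hge := card_nsmul_le_sum (served k (eligible h v T)) v x fun i hi =>
        hxZ.trans (mem_filter.1 (mem_filter.1 hi).1).2
      rw [nsmul_eq_mul] at hge
      exact (mul_le_mul_of_nonneg_right (by exact_mod_cast hs) hx).trans hge
    have hsum : h * x ≤ ∑ i ∈ served k (eligible h v S), v i +
        ∑ i ∈ served k (eligible h v Sᶜ), v i := by
      rcases le_total (samplePrice h v S) (samplePrice h v Sᶜ) with hle | hle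
      · linarith [main S hgood.1 hgood.2 hle, hF0 Sᶜ]
      · have := main Sᶜ hgood.2 (by rw [compl_compl]; exact hgood.1)
          (by rwa [compl_compl])
        linarith [hF0 S]
    refine le_trans (mul_le_of_le_one_right (by positivity) ?_) hsum
    have : 0 ≤ (2 * ((S ∩ G).card : ℝ) - G.card) ^ 2 / (G.card - 2 * h) ^ 2 := by positivity
    linarith
  · refine le_trans (mul_nonpos_of_nonneg_of_nonpos (by positivity) ?_)
      (add_nonneg (hF0 S) (hF0 Sᶜ))
    rw [sub_nonpos, one_le_div (by positivity)]
    rcases not_and_or.1 hgood with hlt | hlt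
    · have : ((S ∩ G).card : ℝ) < h := by exact_mod_cast not_le.1 hlt
      nlinarith
    · have : ((Sᶜ ∩ G).card : ℝ) < h := by exact_mod_cast not_le.1 hlt
      nlinarith

lemma sum_served_lower {n k h : ℕ} (hh : 0 < h) (hhk : h ≤ k) {v : Fin n → ℝ}
    (hv : ∀ i, 0 < v i) {x : ℝ} (hx : 0 ≤ x)
    (hg : 4 * h ≤ (univ.filter fun i => x ≤ v i).card) :
    Fintype.card (Finset (Fin n)) *
        (h * x * (1 - 4 / (univ.filter fun i => x ≤ v i).card) / 2) ≤
      ∑ S : Finset (Fin n), ∑ i ∈ served k (eligible h v S), v i := by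
  set G := univ.filter fun i => x ≤ v i with hG
  have hsum := sum_le_sum fun S (_ : S ∈ (univ : Finset (Finset (Fin n)))) =>
    served_pair_lower hh hhk hv hx (hG ▸ (by omega : 2 * h < G.card)) S
  have hcompl : ∑ S : Finset (Fin n), ∑ i ∈ served k (eligible h v Sᶜ), v i =
      ∑ S : Finset (Fin n), ∑ i ∈ served k (eligible h v S), v i :=
    Equiv.sum_comp (Function.Involutive.toPerm _ (compl_involutive (α := Finset (Fin n))))
      fun S => ∑ i ∈ served k (eligible h v S), v i
  rw [sum_add_distrib, hcompl, ← mul_sum, sum_sub_distrib, ← sum_div,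
    sum_sq_two_card_inter_sub, ← hG] at hsum
  simp only [sum_const, card_univ, nsmul_eq_mul, mul_one] at hsum
  have hgR : 4 * (h : ℝ) ≤ G.card := by exact_mod_cast hg
  have hhR : (0 : ℝ) < h := by exact_mod_cast hh
  have hg0 : (0 : ℝ) < G.card := by linarith
  have hd : (G.card : ℝ) / (G.card - 2 * h) ^ 2 ≤ 4 / G.card := by
    rw [div_le_div_iff₀ (by nlinarith) hg0]
    nlinarith
  have hN : (0 : ℝ) ≤ Fintype.card (Finset (Fin n)) := by positivity
  have h2 : Fintype.card (Finset (Fin n)) * (h * x * (1 - 4 / (G.card : ℝ))) ≤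
      h * x * (Fintype.card (Finset (Fin n)) -
        Fintype.card (Finset (Fin n)) * (G.card : ℝ) / (G.card - 2 * h) ^ 2) := by
    have : Fintype.card (Finset (Fin n)) * (h * x * (1 - 4 / (G.card : ℝ))) ≤
        Fintype.card (Finset (Fin n)) *
          (h * x * (1 - (G.card : ℝ) / (G.card - 2 * h) ^ 2)) := by gcongr
    refine this.trans_eq ?_
    ring
  linarith

/-! ### Upper bounds on the optimum -/

lemma sum_comp_le_of_feasible {n k : ℕ} {π : Fin n → Fin (k + 1)} (hπ : Feasible n k π)
    {w : Fin (k + 1) → ℝ} (hw : ∀ j, 0 ≤ w j) (hlast : w (Fin.last k) = 0) :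
    ∑ i, w (π i) ≤ ∑ j, w j := by
  rw [← sum_fiberwise univ π]
  refine sum_le_sum fun j _ => ?_
  rw [sum_congr rfl fun i hi => by rw [(mem_filter.1 hi).2], sum_const, nsmul_eq_mul]
  rcases eq_or_ne j (Fin.last k) with rfl | hj
  · simp [hlast]
  · have hlt : (j : ℕ) < k := Fin.val_lt_last hj
    have hc : (univ.filter fun i => π i = j).card ≤ 1 := card_le_one.2 fun a ha b hb => by
      have ha' := (mem_filter.1 ha).2
      have hb' := (mem_filter.1 hb).2
      exact hπ a b (ha'.trans hb'.symm) (by rwa [ha'])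
    exact mul_le_of_le_one_left (hw j) (by exact_mod_cast hc)

lemma OPT_le {n k : ℕ} {α : Fin k → ℝ} {v : Fin n → ℝ} {B : ℝ}
    (hB : ∀ π, Feasible n k π → welfare n k α v π ≤ B) : OPT n k α v ≤ B := by
  refine csSup_le ⟨_, fun _ => Fin.last k, ?_, rfl⟩ ?_
  · intro i j _ hlt
    simp at hlt
  · rintro w ⟨π, hπ, rfl⟩
    exact hB π hπ

lemma OPT_le_sum_mul {n k : ℕ} {α : Fin k → ℝ} (hα : ∀ j, 0 ≤ α j) {v : Fin n → ℝ} {M : ℝ}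
    (hM : 0 ≤ M) (hvM : ∀ i, v i ≤ M) : OPT n k α v ≤ (∑ j, α j) * M := by
  refine OPT_le fun π hπ => ?_
  have hs := sum_comp_le_of_feasible hπ (ctr_nonneg hα) (ctr_last k α)
  have hctr : ∑ j, ctr k α j = ∑ j, α j := by
    rw [Fin.sum_univ_castSucc, ctr_last, add_zero]
    exact sum_congr rfl fun j _ => by simp [ctr]
  calc welfare n k α v π ≤ ∑ i, M * ctr k α (π i) :=
        sum_le_sum fun i _ => mul_le_mul_of_nonneg_right (hvM i) (ctr_nonneg hα _)
    _ = (∑ i, ctr k α (π i)) * M := by rw [← mul_sum, mul_comm]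
    _ ≤ (∑ j, α j) * M := by
        rw [← hctr]
        exact mul_le_mul_of_nonneg_right hs hM

lemma OPT_le_card_filter {n k : ℕ} {α : Fin k → ℝ} (hα : ∀ j, 0 ≤ α j) {a : ℝ} (ha : 0 ≤ a)
    (hαa : ∀ j, α j ≤ a) {v : Fin n → ℝ} {M x : ℝ} (hM : 0 ≤ M) (hvM : ∀ i, v i ≤ M)
    (hx : 0 ≤ x) :
    OPT n k α v ≤ a * ((univ.filter fun i => x ≤ v i).card * M + k * x) := by
  refine OPT_le fun π hπ => ?_
  set w : Fin (k + 1) → ℝ := fun j => if j = Fin.last k then 0 else 1 with hw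
  have hw0 : ∀ j, 0 ≤ w j := fun j => by
    simp only [hw]
    split_ifs <;> norm_num
  have hs := sum_comp_le_of_feasible hπ hw0 (by simp [hw])
  have hwk : ∑ j, w j = k := by
    rw [Fin.sum_univ_castSucc]
    simp [hw, Fin.castSucc_ne_last]
  have hterm : ∀ i, v i * ctr k α (π i) ≤ a * ((if x ≤ v i then 1 else 0) * M + w (π i) * x) := by
    intro i
    rcases eq_or_ne (π i) (Fin.last k) with hi | hi
    · rw [hi, ctr_last, mul_zero]
      have := hw0 (Fin.last k)
      split_ifs <;> positivity
    · have hwi : w (π i) = 1 := by simp [hw, hi]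
      have hca : ctr k α (π i) ≤ a := by
        unfold ctr
        split_ifs
        · exact hαa _
        · exact ha
      have hv' : v i ≤ (if x ≤ v i then 1 else 0) * M + w (π i) * x := by
        rw [hwi]
        split_ifs with h
        · linarith [hvM i]
        · linarith
      have hr : 0 ≤ (if x ≤ v i then 1 else 0) * M + w (π i) * x := by
        rw [hwi]
        split_ifs <;> linarith
      calc v i * ctr k α (π i)
          ≤ ((if x ≤ v i then 1 else 0) * M + w (π i) * x) * ctr k α (π i) :=
            mul_le_mul_of_nonneg_right hv' (ctr_nonneg hα _)
        _ ≤ ((if x ≤ v i then 1 else 0) * M + w (π i) * x) * a :=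
            mul_le_mul_of_nonneg_left hca hr
        _ = _ := mul_comm _ _
  calc welfare n k α v π
      ≤ ∑ i, a * ((if x ≤ v i then 1 else 0) * M + w (π i) * x) := sum_le_sum fun i _ => hterm i
    _ = a * ((univ.filter fun i => x ≤ v i).card * M + (∑ i, w (π i)) * x) := by
        rw [← mul_sum, sum_add_distrib, ← sum_mul, ← sum_mul, sum_boole]
    _ ≤ _ := by
        rw [hwk] at hs
        gcongr

lemma one_sub_sqrt_one_sub_le {y : ℝ} (hy : 0 ≤ y) (hy' : y ≤ 3 / 4) :
    1 - Real.sqrt (1 - y) ≤ 2 / 3 * y := by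
  have : 1 - 2 / 3 * y ≤ Real.sqrt (1 - y) := Real.le_sqrt_of_sq_le (by nlinarith)
  linarith

/-- Welfare guarantee of the queue mechanism, averaged over the sample and the cyclic shift. -/
lemma sum_welfare_queue_lower {n k : ℕ} (hk : 1 ≤ k) (hkn : k ≤ n)
    {α : Fin k → ℝ} (hα : ∀ j, 0 ≤ α j)
    (hmono : ∀ j j' : Fin k, j ≤ j' → α j' ≤ α j)
    {ρ : ℝ} (hρ : 36 ≤ ρ) {v : Fin n → ℝ} (hv : ∀ i, 0 < v i)
    (hlarge : ∀ i, v i * α ⟨0, hk⟩ < OPT n k α v / ρ) :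
    (Fintype.card (Finset (Fin n)) * k : ℝ) *
        (3 / 8 * (1 - Real.sqrt (1 - ρ / (3 * k))) ^ 2 * OPT n k α v) ≤
      ∑ S : Finset (Fin n), ∑ t : Fin k,
        welfare n k α v (queueSlot (eligible ⌊ρ / 8⌋₊ v S) t) := by
  have hkR : (0 : ℝ) < k := by exact_mod_cast hk
  have hρ0 : 0 < ρ := by linarith
  obtain ⟨i₀, -, hmax⟩ := exists_max_image (univ : Finset (Fin n)) v ⟨⟨0, by omega⟩, mem_univ _⟩
  have hvM : ∀ i, v i ≤ v i₀ := fun i => hmax i (mem_univ i)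
  have hM := hv i₀
  set M := v i₀
  set a := α ⟨0, hk⟩
  have hαa : ∀ j, α j ≤ a := fun j => hmono _ _ (Nat.zero_le _)
  have ha : 0 ≤ a := hα _
  have hlt : ρ * (M * a) < OPT n k α v := by
    have := (lt_div_iff₀ hρ0).1 (hlarge i₀)
    linarith
  have hcard : ∀ x, 0 ≤ x →
      ρ * (M * a) < a * ((univ.filter fun i => x ≤ v i).card * M + k * x) := fun x hx =>
    hlt.trans_le (OPT_le_card_filter hα ha hαa hM.le hvM hx)
  have hA := OPT_le_sum_mul hα hM.le hvM
  have hAk : ∑ j, α j ≤ k * a := by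
    have := sum_le_card_nsmul univ α a fun j _ => hαa j
    simpa using this
  have ha' : 0 < a := by
    refine lt_of_le_of_ne ha fun h0 => ?_
    have := hcard 0 le_rfl
    rw [← h0] at this
    simp at this
  have hOPT : 0 ≤ OPT n k α v := le_trans (by positivity) hlt.le
  have hρk : ρ < k := by
    have h1 : ρ * (M * a) < k * a * M :=
      hlt.trans_le (hA.trans (mul_le_mul_of_nonneg_right hAk hM.le))
    have h2 : ρ * (M * a) < k * (M * a) := by linarith
    exact lt_of_mul_lt_mul_right h2 (by positivity)
  set x := M * ρ / (2 * k) with hx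
  have hx0 : 0 ≤ x := by positivity
  set g := (univ.filter fun i => x ≤ v i).card with hg
  have hgρ : ρ / 2 < g := by
    have h1 := hcard x hx0
    have h2 : (k : ℝ) * x = M * ρ / 2 := by
      rw [hx]
      field_simp
    rw [h2, ← hg] at h1
    have h3 : ρ / 2 * (M * a) < g * (M * a) := by linarith
    exact lt_of_mul_lt_mul_right h3 (by positivity)
  set h := ⌊ρ / 8⌋₊ with hh
  have hle : (h : ℝ) ≤ ρ / 8 := Nat.floor_le (by positivity)
  have hgt : ρ / 8 < h + 1 := Nat.lt_floor_add_one _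
  have h4 : 4 ≤ h := Nat.le_floor (by push_cast; linarith)
  have hlow : ρ / 10 ≤ h := by
    have h4R : (4 : ℝ) ≤ h := by exact_mod_cast h4
    rcases le_total ρ 40 with h40 | h40 <;> linarith
  have hgh : 4 * h ≤ g := by
    have : (4 : ℝ) * h ≤ g := by linarith
    exact_mod_cast this
  have hhk : h ≤ k := by
    have : (h : ℝ) ≤ k := by linarith
    exact_mod_cast this
  have hserved := sum_served_lower (k := k) (by omega) hhk hv hx0 hgh
  rw [← hg] at hserved
  simp only [sum_welfare_queueSlot]
  rw [← mul_sum]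
  set N : ℝ := (Fintype.card (Finset (Fin n)) : ℝ)
  have hN : 0 ≤ N := Nat.cast_nonneg _
  set A := ∑ j, α j
  have hA0 : 0 ≤ A := sum_nonneg fun j _ => hα j
  have hfrac : (7 : ℝ) / 9 ≤ 1 - 4 / g := by
    have : (4 : ℝ) / g ≤ 2 / 9 := by
      rw [div_le_div_iff₀ (by linarith) (by norm_num)]
      linarith
    linarith
  have hsq : (1 - Real.sqrt (1 - ρ / (3 * k))) ^ 2 ≤ (2 / 3 * (ρ / (3 * k))) ^ 2 := by
    apply pow_le_pow_left₀
    · rw [sub_nonneg]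
      refine Real.sqrt_le_one.2 ?_
      have : 0 ≤ ρ / (3 * k) := by positivity
      linarith
    · apply one_sub_sqrt_one_sub_le (by positivity)
      rw [div_le_iff₀ (by positivity)]
      linarith
  calc N * k * (3 / 8 * (1 - Real.sqrt (1 - ρ / (3 * k))) ^ 2 * OPT n k α v)
      ≤ N * k * (3 / 8 * (2 / 3 * (ρ / (3 * k))) ^ 2 * (A * M)) := by gcongr
    _ = A * N * (M * ρ ^ 2 / k) * (1 / 54) := by
        field_simp
        ring
    _ ≤ A * N * (M * ρ ^ 2 / k) * (7 / 360) :=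
        mul_le_mul_of_nonneg_left (by norm_num) (by positivity)
    _ = A * (N * (ρ / 10 * x * (7 / 9) / 2)) := by
        rw [hx]
        field_simp
        ring
    _ ≤ A * (N * (h * x * (1 - 4 / g) / 2)) := by gcongr
    _ ≤ _ := mul_le_mul_of_nonneg_left hserved hA0

/-- Theorem 5: a universally truthful uniform-price randomized mechanism exists whose
expected welfare at the truthful report is at least
`(3/8)(1 - √(1 - ρ/(3k)))² · OPT` on every large-market profile. A mechanism is
uniform-price if at every reported profile there is a single unit price `Z ≥ 0` such that
every bidder pays `Z` times the CTR of her assigned slot (in particular unassigned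
bidders, who get the dummy slot of CTR `0`, pay `0`). -/
theorem uniform_price_large_market (n k : ℕ) (hk : 1 ≤ k) (hkn : k ≤ n)
    (α : Fin k → ℝ) (hα : ∀ j, 0 ≤ α j)
    (hmono : ∀ j j' : Fin k, j ≤ j' → α j' ≤ α j)
    (ρ : ℝ) (hρ₁ : 36 ≤ ρ) (hρ₂ : ρ ≤ 3 * k) :
    ∃ (m : ℕ) (μ : Fin m → ℝ)
      (asg : Fin m → (Fin n → ℝ) → (Fin n → ℝ) → Fin n → Fin (k + 1))
      (pay : Fin m → (Fin n → ℝ) → (Fin n → ℝ) → Fin n → ℝ),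
      (∀ ω, 0 ≤ μ ω) ∧ (∑ ω, μ ω) = 1 ∧
      (∀ ω b g, Feasible n k (asg ω b g)) ∧
      (∀ ω, TruthfulPriv n k α (asg ω) (pay ω)) ∧
      (∀ ω b g, ∃ Z : ℝ, 0 ≤ Z ∧ ∀ i, pay ω b g i = Z * ctr k α (asg ω b g i)) ∧
      ∀ v γ : Fin n → ℝ, (∀ i, 0 < v i) → (∀ i, 0 ≤ γ i) →
        (∀ i, v i * α ⟨0, hk⟩ < OPT n k α v / ρ) →
        (∑ ω, μ ω * welfare n k α v (asg ω v γ)) ≥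
          3 / 8 * (1 - Real.sqrt (1 - ρ / (3 * k))) ^ 2 * OPT n k α v := by
  have hkR : (0 : ℝ) < k := by exact_mod_cast hk
  have hN : (0 : ℝ) < Fintype.card (Finset (Fin n)) := by exact_mod_cast Fintype.card_pos
  let e := Fintype.equivFin (Finset (Fin n) × Fin k)
  refine ⟨Fintype.card (Finset (Fin n) × Fin k),
    fun _ => 1 / (Fintype.card (Finset (Fin n)) * k : ℝ),
    fun ω b _ => queueSlot (eligible ⌊ρ / 8⌋₊ b (e.symm ω).1) (e.symm ω).2,
    fun ω b _ i => samplePrice ⌊ρ / 8⌋₊ b (e.symm ω).1 *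
      ctr k α (queueSlot (eligible ⌊ρ / 8⌋₊ b (e.symm ω).1) (e.symm ω).2 i),
    fun _ => by positivity, ?_, fun _ _ _ => queueSlot_feasible _ _,
    fun _ => truthfulPriv_queue hα _ _ _,
    fun _ _ _ => ⟨_, samplePrice_nonneg _ _ _, fun _ => rfl⟩, ?_⟩
  · rw [sum_const, card_univ, Fintype.card_fin, Fintype.card_prod, Fintype.card_fin, nsmul_eq_mul]
    push_cast
    field_simp
  · intro v γ hv _ hlarge
    have hsum := Equiv.sum_comp e.symm fun p : Finset (Fin n) × Fin k =>
      welfare n k α v (queueSlot (eligible ⌊ρ / 8⌋₊ v p.1) p.2)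
    rw [← mul_sum, hsum, Fintype.sum_prod_type, ge_iff_le, one_div_mul_eq_div,
      le_div_iff₀ (by positivity), mul_comm]
    exact sum_welfare_queue_lower hk hkn hα hmono hρ₁ hv hlarge
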